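/- For every ε₀ ∈ (0, π) and every A ≥ 1 there exist constants C > 0 and τ₀ ∈ (0,1), depending only on ε₀ and A, such that for all τ ∈ (0, τ₀), all t₁, t₂ with A⁻¹ τ^{−1/2} < t₁, t₂ < A τ^{−1/2}, and all P₁, P₂ ∈ S³ with geodesic distance d(P₁,P₂) ≥ ε₀, one has ‖ δ_{P₁,t₁}^{1−τ} δ_{P₂,t₂} ‖_{L^{3/2}(S³)} ≤ C τ |log τ|, where the L^{3/2} norm is taken with respect to the surface measure of S³. -/

import Mathlib

open MeasureTheory Real Set Metric
open scoped RealInnerProductSpace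

noncomputable section

/-- The unit sphere `S³ ⊂ ℝ⁴`. -/
abbrev S3 : Set (EuclideanSpace ℝ (Fin 4)) := Metric.sphere (0 : EuclideanSpace ℝ (Fin 4)) 1

/-- The surface (Riemannian volume) measure on `S³`, realized as the measure on the unit
sphere induced by the Lebesgue measure of `ℝ⁴` (so that the total mass is `2π²`). -/
def μS3 : Measure S3 := (volume : Measure (EuclideanSpace ℝ (Fin 4))).toSphere

/-- The standard bubble `δ_{P,t}(x) = t / (1 + ((t²−1)/2)(1 − ⟨x,P⟩))` on `S³`. -/
def bubble (P : S3) (t : ℝ) (x : S3) : ℝ :=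
  t / (1 + ((t ^ 2 - 1) / 2) *
    (1 - ⟪(x : EuclideanSpace ℝ (Fin 4)), (P : EuclideanSpace ℝ (Fin 4))⟫))

/-- The geodesic distance on the unit sphere: `d(P,Q) = arccos ⟨P,Q⟩`. -/
def geoDist (P Q : S3) : ℝ :=
  Real.arccos ⟪(P : EuclideanSpace ℝ (Fin 4)), (Q : EuclideanSpace ℝ (Fin 4))⟫

/-- The Green's function `G_P(Q) = 1/(1 − ⟨P,Q⟩) = 1/(1 − cos d(P,Q))`. -/
def green (P Q : S3) : ℝ :=
  1 / (1 - ⟪(P : EuclideanSpace ℝ (Fin 4)), (Q : EuclideanSpace ℝ (Fin 4))⟫)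

lemma one_sub_inner_eq (x P : S3) :
    1 - ⟪(x : EuclideanSpace ℝ (Fin 4)), (P : EuclideanSpace ℝ (Fin 4))⟫ = dist x P ^ 2 / 2 := by
  have h := norm_sub_sq_real (x : EuclideanSpace ℝ (Fin 4)) P
  rw [Subtype.dist_eq, dist_eq_norm, h]
  simp
  ring

lemma bubble_eq_div_dist (P : S3) (t : ℝ) (x : S3) :
    bubble P t x = t / (1 + (t ^ 2 - 1) / 4 * dist x P ^ 2) := by
  rw [bubble, one_sub_inner_eq]
  congr 1
  ring

lemma dist_le_two (x P : S3) : dist x P ≤ 2 := by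
  rw [Subtype.dist_eq, dist_eq_norm]
  refine (norm_sub_le _ _).trans ?_
  simp; norm_num

lemma bubble_pos {P : S3} {t : ℝ} (ht : 1 ≤ t) (x : S3) : 0 < bubble P t x := by
  rw [bubble_eq_div_dist]
  have : 0 ≤ (t ^ 2 - 1) / 4 * dist x P ^ 2 := mul_nonneg (by nlinarith) (sq_nonneg _)
  exact div_pos (by linarith) (by linarith)

lemma inv_le_bubble {P : S3} {t : ℝ} (ht : 1 ≤ t) (x : S3) : t⁻¹ ≤ bubble P t x := by
  rw [bubble_eq_div_dist]
  have h0 : 0 ≤ (t ^ 2 - 1) / 4 := by nlinarith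
  have hd : dist x P ^ 2 ≤ 4 := by nlinarith [dist_le_two x P, dist_nonneg (x := x) (y := P)]
  have h1 := mul_le_mul_of_nonneg_left hd h0
  have h2 : 0 ≤ (t ^ 2 - 1) / 4 * dist x P ^ 2 := mul_nonneg h0 (sq_nonneg _)
  rw [inv_eq_one_div, div_le_div_iff₀ (by linarith) (by linarith)]
  nlinarith

lemma bubble_le {A s t : ℝ} (hA : 1 ≤ A) (hs : 4 * A ≤ s) (h1 : s / A ≤ t) (h2 : t ≤ A * s)
    (P x : S3) : bubble P t x ≤ 16 * A ^ 3 * s * ((1 + s * dist x P) ^ 2)⁻¹ := by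
  have hs0 : 0 < s := by linarith
  have hd : 0 ≤ dist x P := dist_nonneg
  have ht4 : 4 ≤ t := le_trans (by rw [le_div_iff₀ (by linarith)]; exact hs) h1
  have h3 : s ≤ A * t := by rw [mul_comm]; exact (div_le_iff₀ (by linarith)).1 h1
  have h4 : s ^ 2 ≤ A ^ 2 * t ^ 2 := by rw [← mul_pow]; gcongr
  have hA2 : 1 ≤ A ^ 2 := one_le_pow₀ hA
  have h5 : (1 + s * dist x P) ^ 2 ≤
      16 * A ^ 2 * (1 + (t ^ 2 - 1) / 4 * dist x P ^ 2) := by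
    have e1 : (1 + s * dist x P) ^ 2 ≤ 2 + 2 * (s ^ 2 * dist x P ^ 2) := by
      nlinarith [sq_nonneg (1 - s * dist x P)]
    have e2 : s ^ 2 * dist x P ^ 2 ≤ A ^ 2 * t ^ 2 * dist x P ^ 2 := by gcongr
    have e3 : A ^ 2 * (t ^ 2 * dist x P ^ 2) ≤ A ^ 2 * (2 * (t ^ 2 - 1) * dist x P ^ 2) := by
      gcongr
      nlinarith
    nlinarith
  rw [bubble_eq_div_dist, div_le_iff₀ (by
    have : 0 ≤ (t ^ 2 - 1) / 4 * dist x P ^ 2 := mul_nonneg (by nlinarith) (sq_nonneg _)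
    linarith)]
  have hp : 0 < (1 + s * dist x P) ^ 2 := by positivity
  calc t ≤ A * s := h2
    _ = A * s * ((1 + s * dist x P) ^ 2)⁻¹ * (1 + s * dist x P) ^ 2 := by field_simp
    _ ≤ A * s * ((1 + s * dist x P) ^ 2)⁻¹ *
        (16 * A ^ 2 * (1 + (t ^ 2 - 1) / 4 * dist x P ^ 2)) := by gcongr
    _ = _ := by ring

lemma bubble_rpow_le {τ t : ℝ} (hτ : 0 < τ) (ht : 1 ≤ t) (htτ : t ≤ τ⁻¹) (P x : S3) :
    bubble P t x ^ (1 - τ) ≤ 3 * bubble P t x := by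
  have hb := bubble_pos (P := P) ht x
  have h1 : bubble P t x ^ (-τ) ≤ 3 := by
    calc bubble P t x ^ (-τ) ≤ (t⁻¹) ^ (-τ) :=
          Real.rpow_le_rpow_of_nonpos (by positivity) (inv_le_bubble ht x) (by linarith)
      _ = t ^ τ := by
          rw [Real.inv_rpow (by linarith), Real.rpow_neg (by linarith), inv_inv]
      _ ≤ (τ⁻¹) ^ τ := by gcongr
      _ = Real.exp (Real.log τ⁻¹ * τ) := Real.rpow_def_of_pos (by positivity) _
      _ ≤ Real.exp 1 := by
          gcongr
          calc Real.log τ⁻¹ * τ ≤ τ⁻¹ * τ := by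
                gcongr
                exact (Real.log_le_sub_one_of_pos (by positivity)).trans (by linarith)
            _ = 1 := inv_mul_cancel₀ hτ.ne'
      _ ≤ 3 := by linarith [Real.exp_one_lt_d9]
  rw [sub_eq_add_neg, Real.rpow_add hb, Real.rpow_one, mul_comm 3]
  gcongr

/-- If the geodesic distance is at least `ε`, so is, up to a constant, the chordal one. -/
lemma exists_le_dist_of_le_geoDist {ε : ℝ} (hε : ε ∈ Set.Ioo 0 π) :
    ∃ η > 0, ∀ P Q : S3, ε ≤ geoDist P Q → η ≤ dist P Q := by
  have hcos : Real.cos ε < 1 := by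
    rw [← Real.cos_zero]
    exact Real.cos_lt_cos_of_nonneg_of_le_pi le_rfl hε.2.le hε.1
  refine ⟨√(2 * (1 - Real.cos ε)), Real.sqrt_pos.2 (by linarith), fun P Q h => ?_⟩
  rw [Real.sqrt_le_left dist_nonneg]
  have hinner : |⟪(P : EuclideanSpace ℝ (Fin 4)), (Q : EuclideanSpace ℝ (Fin 4))⟫| ≤ 1 := by
    simpa using abs_real_inner_le_norm (P : EuclideanSpace ℝ (Fin 4)) Q
  rw [abs_le] at hinner
  have := Real.cos_le_cos_of_nonneg_of_le_pi hε.1.le (Real.arccos_le_pi _) h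
  rw [Real.cos_arccos hinner.1 hinner.2] at this
  linarith [one_sub_inner_eq P Q]

/-- Pointwise bound for the product of two bubbles with separated centres. -/
lemma bubble_mul_bubble_le {A s t₁ t₂ η : ℝ} (hA : 1 ≤ A) (hs : 4 * A ≤ s)
    (h1 : s / A ≤ t₁) (h1' : t₁ ≤ A * s) (h2 : s / A ≤ t₂) (h2' : t₂ ≤ A * s) (hη : 0 < η)
    {P₁ P₂ : S3} (hP : η ≤ dist P₁ P₂) (x : S3) :
    (bubble P₁ t₁ x * bubble P₂ t₂ x) ^ ((3 : ℝ) / 2) ≤ (1024 * A ^ 6 / η ^ 2) ^ ((3 : ℝ) / 2) *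
      (((1 + s * dist x P₁) ^ 3)⁻¹ + ((1 + s * dist x P₂) ^ 3)⁻¹) := by
  have hs0 : 0 < s := by linarith
  have hd1 : 0 ≤ dist x P₁ := dist_nonneg
  have hd2 : 0 ≤ dist x P₂ := dist_nonneg
  have hone : 1 ≤ s / A := by rw [le_div_iff₀ (by linarith)]; linarith
  have hb1 := bubble_pos (P := P₁) (hone.trans h1) x
  have hb2 := bubble_pos (P := P₂) (hone.trans h2) x
  have hsep : η / 2 ≤ dist x P₁ ∨ η / 2 ≤ dist x P₂ := by
    by_contra! h
    linarith [dist_triangle_left P₁ P₂ x]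
  have hprod : bubble P₁ t₁ x * bubble P₂ t₂ x ≤
      (16 * A ^ 3 * s * ((1 + s * dist x P₁) ^ 2)⁻¹) *
        (16 * A ^ 3 * s * ((1 + s * dist x P₂) ^ 2)⁻¹) := by
    gcongr
    · exact bubble_le hA hs h1 h1' P₁ x
    · exact bubble_le hA hs h2 h2' P₂ x
  have hfar : ∀ ρ, η / 2 ≤ ρ → ((1 + s * ρ) ^ 2)⁻¹ ≤ 4 / (η ^ 2 * s ^ 2) := by
    intro ρ hρ
    calc ((1 + s * ρ) ^ 2)⁻¹ ≤ ((s * (η / 2)) ^ 2)⁻¹ := by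
          gcongr
          nlinarith
      _ = _ := by field_simp; norm_num
  have hpow : ∀ ρ : ℝ, 0 ≤ ρ → (1024 * A ^ 6 / η ^ 2 * ((1 + s * ρ) ^ 2)⁻¹) ^ ((3 : ℝ) / 2) =
      (1024 * A ^ 6 / η ^ 2) ^ ((3 : ℝ) / 2) * ((1 + s * ρ) ^ 3)⁻¹ := by
    intro ρ hρ
    have hpos : 0 < 1 + s * ρ := by positivity
    rw [Real.mul_rpow (by positivity) (by positivity), Real.inv_rpow (by positivity),
      ← Real.rpow_natCast (1 + s * ρ) 2, ← Real.rpow_mul hpos.le,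
      ← Real.rpow_natCast (1 + s * ρ) 3]
    norm_num
  rw [mul_add]
  rcases hsep with h | h
  · refine le_trans ?_ (le_add_of_nonneg_left (by positivity))
    rw [← hpow _ hd2]
    refine Real.rpow_le_rpow (by positivity) ?_ (by norm_num)
    calc _ ≤ _ := hprod
      _ ≤ (16 * A ^ 3 * s * (4 / (η ^ 2 * s ^ 2))) *
        (16 * A ^ 3 * s * ((1 + s * dist x P₂) ^ 2)⁻¹) := by gcongr; exact hfar _ h
      _ = _ := by field_simp; ring
  · refine le_trans ?_ (le_add_of_nonneg_right (by positivity))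
    rw [← hpow _ hd1]
    refine Real.rpow_le_rpow (by positivity) ?_ (by norm_num)
    calc _ ≤ _ := hprod
      _ ≤ (16 * A ^ 3 * s * ((1 + s * dist x P₁) ^ 2)⁻¹) *
        (16 * A ^ 3 * s * (4 / (η ^ 2 * s ^ 2))) := by gcongr; exact hfar _ h
      _ = _ := by field_simp; ring

open scoped Pointwise in
lemma cap_measure_le : ∃ C > 0, ∀ (P : S3) (r : ℝ), 0 < r → r ≤ 5 →
    μS3.real {x : S3 | dist x P ≤ r} ≤ C * r ^ 3 := by
  set c := (volume : Measure (EuclideanSpace ℝ (Fin 4))).real (closedBall 0 1) with hc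
  have hc0 : 0 ≤ c := measureReal_nonneg
  refine ⟨384 * c + 1, by positivity, fun P r hr hr5 => ?_⟩
  set N := ⌊1 / r⌋₊ with hN
  have hcover : Ioo (0 : ℝ) 1 • Set.image Subtype.val {x : S3 | dist x P ≤ r} ⊆
      ⋃ k ∈ Finset.range (N + 1),
        closedBall ((k * r) • (P : EuclideanSpace ℝ (Fin 4))) (2 * r) := by
    rintro _ ⟨ρ, ⟨hρ0, hρ1⟩, _, ⟨x, hx, rfl⟩, rfl⟩
    have hx : ‖(x : EuclideanSpace ℝ (Fin 4)) - P‖ ≤ r := by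
      rw [← dist_eq_norm]; exact hx
    have hP : ‖(P : EuclideanSpace ℝ (Fin 4))‖ = 1 := by simp
    have hfl : (⌊ρ / r⌋₊ : ℝ) * r ≤ ρ := by
      rw [← le_div_iff₀ hr]; exact Nat.floor_le (by positivity)
    have hlf : ρ < ((⌊ρ / r⌋₊ : ℝ) + 1) * r := by
      rw [← div_lt_iff₀ hr]; exact Nat.lt_floor_add_one _
    simp only [mem_iUnion]
    refine ⟨⌊ρ / r⌋₊, ?_, ?_⟩
    · rw [Finset.mem_range, Nat.lt_succ_iff]
      exact Nat.floor_le_floor (by gcongr)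
    · rw [mem_closedBall, dist_eq_norm]
      have : ρ • (x : EuclideanSpace ℝ (Fin 4)) - ((⌊ρ / r⌋₊ : ℝ) * r) • (P : EuclideanSpace ℝ (Fin 4))
          = ρ • ((x : EuclideanSpace ℝ (Fin 4)) - P) + (ρ - (⌊ρ / r⌋₊ : ℝ) * r) • (P : EuclideanSpace ℝ (Fin 4)) := by
        module
      change ‖ρ • (x : EuclideanSpace ℝ (Fin 4)) - ((⌊ρ / r⌋₊ : ℝ) * r) • (P : EuclideanSpace ℝ (Fin 4))‖ ≤ _
      rw [this]
      refine (norm_add_le _ _).trans ?_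
      rw [norm_smul, norm_smul, hP, Real.norm_of_nonneg hρ0.le, Real.norm_of_nonneg (by linarith)]
      nlinarith [norm_nonneg ((x : EuclideanSpace ℝ (Fin 4)) - P)]
  have hball : ∀ y : EuclideanSpace ℝ (Fin 4),
      (volume : Measure (EuclideanSpace ℝ (Fin 4))).real (closedBall y (2 * r))
        = 16 * r ^ 4 * c := by
    intro y
    rw [Measure.addHaar_real_closedBall' _ _ (by positivity), finrank_euclideanSpace_fin, hc]
    ring
  have hmeas : MeasurableSet {x : S3 | dist x P ≤ r} :=
    measurableSet_le (by fun_prop) measurable_const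
  have h1 : μS3.real {x : S3 | dist x P ≤ r} = 4 *
      (volume : Measure (EuclideanSpace ℝ (Fin 4))).real
        (Ioo (0 : ℝ) 1 • Set.image Subtype.val {x : S3 | dist x P ≤ r}) := by
    rw [μS3, Measure.real, Measure.toSphere_apply' _ hmeas, ENNReal.toReal_mul,
      finrank_euclideanSpace_fin]
    norm_num [Measure.real]
  have h2 : (volume : Measure (EuclideanSpace ℝ (Fin 4))).real
      (Ioo (0 : ℝ) 1 • Set.image Subtype.val {x : S3 | dist x P ≤ r}) ≤ (N + 1) * (16 * r ^ 4 * c) := by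
    refine (measureReal_mono hcover ?_).trans ((measureReal_biUnion_finset_le _ _).trans ?_)
    · exact ((measure_biUnion_finset_le _ _).trans_lt
        (ENNReal.sum_lt_top.2 fun k _ => measure_closedBall_lt_top)).ne
    · simp [hball]
  have h3 : (N : ℝ) * r ≤ 1 := by
    rw [← le_div_iff₀ hr]; exact Nat.floor_le (by positivity)
  have h4 : (N + 1) * (16 * r ^ 4 * c) ≤ 96 * c * r ^ 3 := by
    have : (N * r + r) * (16 * r ^ 3 * c) ≤ 6 * (16 * r ^ 3 * c) := by
      gcongr; linarith
    linarith
  rw [h1]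
  have : 0 < r ^ 3 := by positivity
  linarith

lemma isFiniteMeasure_μS3 : IsFiniteMeasure μS3 := by
  unfold μS3; infer_instance

lemma exists_dominating_sum : ∃ C > 0, ∀ (P : S3) (s : ℝ), 4 ≤ s → ∃ g : S3 → ℝ,
    Integrable g μS3 ∧ (∀ x, ((1 + s * dist x P) ^ 3)⁻¹ ≤ g x) ∧
      ∫ x, g x ∂μS3 ≤ C * (s ^ 3)⁻¹ * Real.log s := by
  have := isFiniteMeasure_μS3
  obtain ⟨C, hC, hcap⟩ := cap_measure_le
  refine ⟨8 * C * 5, by positivity, fun P s hs => ?_⟩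
  set N := ⌊Real.log (1 + 2 * s) / Real.log 2⌋₊ with hN
  have hl2 : 0 < Real.log 2 := Real.log_pos (by norm_num)
  have hN_iff : ∀ n : ℕ, (2 : ℝ) ^ n ≤ 1 + 2 * s ↔ n ≤ N := by
    intro n
    have h : 0 ≤ Real.log (1 + 2 * s) / Real.log 2 :=
      div_nonneg (Real.log_nonneg (by linarith)) hl2.le
    rw [hN, Nat.le_floor_iff h, le_div_iff₀ hl2, ← Real.log_pow,
      Real.log_le_log_iff (by positivity) (by linarith)]
  have hmeas : ∀ r : ℝ, MeasurableSet {x : S3 | dist x P ≤ r} := fun r =>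
    measurableSet_le (by fun_prop) measurable_const
  have hint : ∀ n : ℕ, Integrable
      ({x : S3 | dist x P ≤ 2 ^ (n + 1) / s}.indicator fun _ => ((2 ^ n) ^ 3 : ℝ)⁻¹) μS3 :=
    fun n => (integrable_const _).indicator (hmeas _)
  refine ⟨fun x => ∑ n ∈ Finset.range (N + 1),
    {x : S3 | dist x P ≤ 2 ^ (n + 1) / s}.indicator (fun _ => ((2 ^ n) ^ 3 : ℝ)⁻¹) x,
    integrable_finsetSum _ fun n _ => hint n, fun x => ?_, ?_⟩
  · have hd : dist x P ≤ 2 := dist_le_two x P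
    have hd0 : 0 ≤ dist x P := dist_nonneg
    obtain ⟨n, hn1, hn2⟩ := exists_nat_pow_near (x := 1 + s * dist x P) (y := 2)
      (by nlinarith) (by norm_num)
    have hnN : n ∈ Finset.range (N + 1) := by
      rw [Finset.mem_range, Nat.lt_succ_iff, ← hN_iff]
      nlinarith
    refine le_trans ?_ (Finset.single_le_sum (f := fun n => {x : S3 | dist x P ≤ 2 ^ (n + 1) / s}.indicator (fun _ => ((2 ^ n) ^ 3 : ℝ)⁻¹) x)
      (fun i _ => indicator_nonneg (fun _ _ => by positivity) _) hnN)
    have hmem : x ∈ {x : S3 | dist x P ≤ 2 ^ (n + 1) / s} := by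
      rw [mem_ofPred_eq, le_div_iff₀ (by linarith)]
      linarith
    simp only [indicator_of_mem hmem]
    gcongr
  · rw [integral_finsetSum _ fun n _ => hint n]
    have hterm : ∀ n ∈ Finset.range (N + 1), ∫ x, {x : S3 | dist x P ≤ 2 ^ (n + 1) / s}.indicator
        (fun _ => ((2 ^ n) ^ 3 : ℝ)⁻¹) x ∂μS3 ≤ 8 * C * (s ^ 3)⁻¹ := by
      intro n hn
      rw [Finset.mem_range, Nat.lt_succ_iff, ← hN_iff] at hn
      rw [integral_indicator_const _ (hmeas _), smul_eq_mul]
      have := hcap P (2 ^ (n + 1) / s) (by positivity) (by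
        rw [div_le_iff₀ (by linarith), pow_succ]; linarith)
      calc _ ≤ C * (2 ^ (n + 1) / s) ^ 3 * ((2 ^ n) ^ 3 : ℝ)⁻¹ := by gcongr
        _ = _ := by field_simp; ring
    refine (Finset.sum_le_sum hterm).trans ?_
    rw [Finset.sum_const, Finset.card_range, nsmul_eq_mul]
    have h2s : Real.log 2 * 2 ≤ Real.log s := by
      rw [mul_comm, show (2 : ℝ) * Real.log 2 = Real.log (2 ^ 2) by rw [Real.log_pow]; norm_num]
      exact Real.log_le_log (by norm_num) (by linarith)
    have hNle : ((N + 1 : ℕ) : ℝ) ≤ 5 * Real.log s := by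
      have h1 : (N : ℝ) * Real.log 2 ≤ Real.log (1 + 2 * s) := by
        rw [← Real.log_pow]
        exact Real.log_le_log (by positivity) ((hN_iff N).2 le_rfl)
      have h2 : Real.log (1 + 2 * s) ≤ 2 * Real.log s := by
        rw [show 2 * Real.log s = Real.log (s ^ 2) by rw [Real.log_pow]; norm_num]
        exact Real.log_le_log (by linarith) (by nlinarith)
      have h3 : (0.69 : ℝ) < Real.log 2 := by linarith [Real.log_two_gt_d9]
      push_cast
      nlinarith [N.cast_nonneg (α := ℝ)]
    calc _ ≤ 5 * Real.log s * (8 * C * (s ^ 3)⁻¹) := by gcongr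
      _ = _ := by ring

theorem stmt15 (ε₀ A : ℝ) (hε₀ : ε₀ ∈ Set.Ioo 0 π) (hA : 1 ≤ A) :
    ∃ C > 0, ∃ τ₀ ∈ Set.Ioo (0 : ℝ) 1, ∀ τ ∈ Set.Ioo (0 : ℝ) τ₀, ∀ t₁ t₂ : ℝ,
      A⁻¹ * τ ^ (-(1 : ℝ) / 2) < t₁ → t₁ < A * τ ^ (-(1 : ℝ) / 2) →
      A⁻¹ * τ ^ (-(1 : ℝ) / 2) < t₂ → t₂ < A * τ ^ (-(1 : ℝ) / 2) →
      ∀ P₁ P₂ : S3, ε₀ ≤ geoDist P₁ P₂ →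
      (∫ x, |(bubble P₁ t₁ x) ^ ((1 : ℝ) - τ) * bubble P₂ t₂ x| ^ ((3 : ℝ) / 2) ∂μS3) ^
          ((2 : ℝ) / 3) ≤ C * τ * |Real.log τ| := by
  obtain ⟨η, hη, hsep⟩ := exists_le_dist_of_le_geoDist hε₀
  obtain ⟨C, hC, hdom⟩ := exists_dominating_sum
  set M := (1024 * A ^ 6 / η ^ 2) ^ ((3 : ℝ) / 2)
  have hM0 : 0 < M := by positivity
  set K := (3 : ℝ) ^ ((3 : ℝ) / 2) * M * (2 * C) with hK
  have hK0 : 0 < K := by positivity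
  clear_value K
  refine ⟨K ^ ((2 : ℝ) / 3), by positivity, ((4 * A) ^ 2)⁻¹, ⟨by positivity, ?_⟩, ?_⟩
  · exact inv_lt_one_of_one_lt₀ (by nlinarith)
  intro τ ⟨hτ0, hτ1⟩ t₁ t₂ h1 h1' h2 h2' P₁ P₂ hP
  set s := τ ^ (-(1 : ℝ) / 2) with hs
  have hs0 : 0 < s := by positivity
  have hsτ : (s ^ 2)⁻¹ = τ := by
    rw [hs, ← Real.rpow_natCast, ← Real.rpow_mul hτ0.le, ← Real.rpow_neg hτ0.le]
    norm_num
  have hsA : 4 * A ≤ s := by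
    rw [← hsτ] at hτ1
    have := (inv_lt_inv₀ (by positivity) (by positivity)).1 hτ1
    exact (lt_of_pow_lt_pow_left₀ 2 hs0.le this).le
  have hs4 : 4 ≤ s := by linarith
  rw [inv_mul_eq_div] at h1 h2
  have hone : 1 ≤ s / A := by rw [le_div_iff₀ (by linarith)]; linarith
  have ht1 : 1 ≤ t₁ := hone.trans h1.le
  have ht2 : 1 ≤ t₂ := hone.trans h2.le
  have htτ : t₁ ≤ τ⁻¹ := by
    rw [← hsτ, inv_inv]
    nlinarith
  have hlog : 1 ≤ Real.log s := by
    rw [Real.le_log_iff_exp_le hs0]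
    linarith [Real.exp_one_lt_d9]
  have hlogτ : |Real.log τ| = 2 * Real.log s := by
    rw [← hsτ, Real.log_inv, Real.log_pow, abs_neg, abs_of_nonneg (by positivity)]
    norm_num
  obtain ⟨g₁, hg₁, hle₁, hint₁⟩ := hdom P₁ s hs4
  obtain ⟨g₂, hg₂, hle₂, hint₂⟩ := hdom P₂ s hs4
  have hpt : ∀ x, |(bubble P₁ t₁ x) ^ ((1 : ℝ) - τ) * bubble P₂ t₂ x| ^ ((3 : ℝ) / 2) ≤
      3 ^ ((3 : ℝ) / 2) * M * (g₁ x + g₂ x) := by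
    intro x
    have hb1 := bubble_pos (P := P₁) ht1 x
    have hb2 := bubble_pos (P := P₂) ht2 x
    calc |(bubble P₁ t₁ x) ^ ((1 : ℝ) - τ) * bubble P₂ t₂ x| ^ ((3 : ℝ) / 2)
        ≤ (3 * (bubble P₁ t₁ x * bubble P₂ t₂ x)) ^ ((3 : ℝ) / 2) := by
          rw [abs_of_nonneg (by positivity), ← mul_assoc]
          gcongr
          exact bubble_rpow_le hτ0 ht1 htτ P₁ x
      _ = 3 ^ ((3 : ℝ) / 2) * (bubble P₁ t₁ x * bubble P₂ t₂ x) ^ ((3 : ℝ) / 2) :=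
          Real.mul_rpow (by norm_num) (by positivity)
      _ ≤ 3 ^ ((3 : ℝ) / 2) *
          (M * (((1 + s * dist x P₁) ^ 3)⁻¹ + ((1 + s * dist x P₂) ^ 3)⁻¹)) := by
          gcongr
          exact bubble_mul_bubble_le hA hsA h1.le h1'.le h2.le h2'.le hη (hsep P₁ P₂ hP) x
      _ ≤ 3 ^ ((3 : ℝ) / 2) * (M * (g₁ x + g₂ x)) := by
          gcongr
          · exact hle₁ x
          · exact hle₂ x
      _ = _ := by ring
  have hI : ∫ x, |(bubble P₁ t₁ x) ^ ((1 : ℝ) - τ) * bubble P₂ t₂ x| ^ ((3 : ℝ) / 2) ∂μS3 ≤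
      K * ((s ^ 3)⁻¹ * Real.log s) := by
    calc _ ≤ ∫ x, 3 ^ ((3 : ℝ) / 2) * M * (g₁ x + g₂ x) ∂μS3 :=
          integral_mono_of_nonneg (.of_forall fun x => by positivity)
            ((hg₁.add hg₂).const_mul _) (.of_forall hpt)
      _ = 3 ^ ((3 : ℝ) / 2) * M * (∫ x, g₁ x ∂μS3 + ∫ x, g₂ x ∂μS3) := by
          rw [integral_const_mul, integral_add hg₁ hg₂]
      _ ≤ 3 ^ ((3 : ℝ) / 2) * M *
          (C * (s ^ 3)⁻¹ * Real.log s + C * (s ^ 3)⁻¹ * Real.log s) := by gcongr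
      _ = _ := by rw [hK]; ring
  calc _ ≤ (K * ((s ^ 3)⁻¹ * Real.log s)) ^ ((2 : ℝ) / 3) := by
        gcongr
    _ = K ^ ((2 : ℝ) / 3) * (τ * Real.log s ^ ((2 : ℝ) / 3)) := by
        rw [Real.mul_rpow hK0.le (by positivity), Real.mul_rpow (by positivity) (by positivity),
          Real.inv_rpow (by positivity), ← Real.rpow_natCast s 3, ← Real.rpow_mul hs0.le,
          ← hsτ, ← Real.rpow_natCast s 2]
        norm_num
    _ ≤ K ^ ((2 : ℝ) / 3) * (τ * (2 * Real.log s)) := by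
        gcongr
        calc Real.log s ^ ((2 : ℝ) / 3) ≤ Real.log s ^ (1 : ℝ) :=
              Real.rpow_le_rpow_of_exponent_le hlog (by norm_num)
          _ ≤ 2 * Real.log s := by rw [Real.rpow_one]; linarith
    _ = _ := by rw [hlogτ]; ring
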